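/- For all integers n ≥ 1, 1 ≤ i ≤ n, and 0 ≤ j ≤ i, the number of Catalan tableaux of index n+1 having exactly j ones in the first row and exactly i−j+1 unrestricted rows equals the ballot number (i/(2n−i))·binomial(2n−i, n). -/

import Mathlib

/-- A binary tree: empty, or a root with a left and a right subtree. -/
inductive BinTree : Type
  | nil : BinTree
  | node : BinTree → BinTree → BinTree
  deriving DecidableEq

/-- Number of vertices of a binary tree. -/
def BinTree.size : BinTree → ℕ
  | .nil => 0
  | .node l r => l.size + r.size + 1

/-- Length (number of vertices) of the left branch. -/
def BinTree.leftBranchLen : BinTree → ℕ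
  | .nil => 0
  | .node l _ => l.leftBranchLen + 1

/-- Length (number of vertices) of the right branch. -/
def BinTree.rightBranchLen : BinTree → ℕ
  | .nil => 0
  | .node _ r => r.rightBranchLen + 1

/-- Word over {a,b} (a = `true`, b = `false`) reading the vertices in symmetric
(in-)order; a vertex contributes `true` iff it has a right child. -/
def BinTree.canopyFull : BinTree → List Bool
  | .nil => []
  | .node l r => l.canopyFull ++ (decide (r ≠ BinTree.nil)) :: r.canopyFull

/-- The canopy of a binary tree with `n` vertices: the word `u₁ … u_{n-1}` over
{a = `true`, b = `false`} with `uᵢ = a` iff the `i`-th vertex in symmetric order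
has a right child.  (The last vertex in symmetric order never has a right child,
so it is dropped.) -/
def BinTree.canopy (B : BinTree) : List Bool := B.canopyFull.dropLast

/-- A Catalan tableau of index `n`: a partition `λ₁ ≥ … ≥ λ_k` with `λ₁ = n - k`,
drawn right-justified inside the `k × (n-k)` rectangle (rows bottom to top, row `i`
having `lam i` cells, occupying columns `j` with `m - lam i ≤ j < m` where
`m = n - k`), filled with 0's (`false`) and 1's (`true`) such that every column
contains exactly one 1 and no 0 has both a 1 below it in its column and a 1 to
its right in its row.  Entries outside the diagram are forced to `false`. -/
structure CatalanTableau (n : ℕ) where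
  k : ℕ
  m : ℕ
  hk : 0 < k
  hkm : k + m = n
  lam : Fin k → ℕ
  lam_le : ∀ i, lam i ≤ m
  lam_first : lam ⟨0, hk⟩ = m
  lam_anti : ∀ i j : Fin k, i ≤ j → lam j ≤ lam i
  f : Fin k → Fin m → Bool
  f_outside : ∀ (i : Fin k) (j : Fin m), (j : ℕ) < m - lam i → f i j = false
  col_one : ∀ j : Fin m, ∃! i : Fin k, f i j = true
  no_bad : ∀ (i : Fin k) (j : Fin m), m - lam i ≤ (j : ℕ) → f i j = false →
    ¬ ((∃ i' : Fin k, i' < i ∧ f i' j = true) ∧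
       (∃ j' : Fin m, (j : ℕ) < (j' : ℕ) ∧ f i j' = true))

/-- The profile of a Catalan tableau: the NW border of its Ferrers diagram read
from the bottom-left corner of the rectangle to its top-right corner
(a = `true` for a north step, b = `false` for an east step), with the first
letter (always a north step) deleted. -/
def CatalanTableau.profile {n : ℕ} (T : CatalanTableau n) : List Bool :=
  ((List.finRange T.k).flatMap (fun i =>
    true :: List.replicate
      (T.lam i - (if h : (i : ℕ) + 1 < T.k then T.lam ⟨(i : ℕ) + 1, h⟩ else 0)) false)).tail

/-- Number of 1's in the first (bottom) row of a Catalan tableau. -/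
noncomputable def CatalanTableau.onesFirstRow {n : ℕ} (T : CatalanTableau n) : ℕ :=
  Nat.card {j : Fin T.m // T.f ⟨0, T.hk⟩ j = true}

/-- An entry is restricted if it is a 0 (in a cell of the diagram) lying above
some 1 in its column. -/
def CatalanTableau.Restricted {n : ℕ} (T : CatalanTableau n)
    (i : Fin T.k) (j : Fin T.m) : Prop :=
  T.m - T.lam i ≤ (j : ℕ) ∧ T.f i j = false ∧ ∃ i' : Fin T.k, i' < i ∧ T.f i' j = true

/-- Number of unrestricted rows (rows of the rectangle containing no restricted
entry). -/
noncomputable def CatalanTableau.unrestrictedRows {n : ℕ} (T : CatalanTableau n) : ℕ :=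
  Nat.card {i : Fin T.k // ∀ j : Fin T.m, ¬ T.Restricted i j}

/-- `weaklyBelow ω η`: the lattice paths coded by `ω`, `η` (a = `true` = north
step, b = `false` = east step, both starting at the origin) have the same
endpoints and `η` never passes strictly above `ω`. -/
def weaklyBelow (ω η : List Bool) : Prop :=
  η.length = ω.length ∧ η.count true = ω.count true ∧
    ∀ t : ℕ, (η.take t).count true ≤ (ω.take t).count true

/-- Heights at which the successive east steps of a path occur. -/
def eastHeightsAux : ℕ → List Bool → List ℕ
  | _, [] => []
  | h, true :: w => eastHeightsAux (h + 1) w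
  | h, false :: w => h :: eastHeightsAux h w

def eastHeights (w : List Bool) : List ℕ := eastHeightsAux 0 w

/-- Number of horizontal contacts of two paths: unit east edges traversed by
both paths. -/
def contacts (ω η : List Bool) : ℕ :=
  ((eastHeights ω).zip (eastHeights η)).countP (fun p => p.1 == p.2)

/-- Number of trailing north steps of a path. -/
def trailingNorth (w : List Bool) : ℕ := (w.reverse.takeWhile (· == true)).length

/-- Number of left edges, i.e. of vertices having a left child. -/
def BinTree.leftEdgeCount : BinTree → ℕ
  | .nil => 0
  | .node l r => l.leftEdgeCount + r.leftEdgeCount + (if l = BinTree.nil then 0 else 1)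

/-- Number of vertices having no right child. -/
def BinTree.noRightCount : BinTree → ℕ
  | .nil => 0
  | .node l r => l.noRightCount + r.noRightCount + (if r = BinTree.nil then 1 else 0)

/-- Symmetric-order traversal recording, for each vertex, whether it has a left
child, whether it has a right child, and its right height (the second argument
is the right height of the current root). -/
def BinTree.inorderAux : BinTree → ℕ → List (Bool × Bool × ℕ)
  | .nil, _ => []
  | .node l r, h =>
      BinTree.inorderAux l h ++
        (decide (l ≠ BinTree.nil), decide (r ≠ BinTree.nil), h) :: BinTree.inorderAux r (h + 1)

def BinTree.inorder (B : BinTree) : List (Bool × Bool × ℕ) := B.inorderAux 0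

/-- The sequence `ρ₁, …, ρ_m`: right heights of the parents of the left edges,
the left edges being ordered by their parents in symmetric order. -/
def BinTree.rhoList (B : BinTree) : List ℕ :=
  (B.inorder.filter (fun v => v.1)).map (fun v => v.2.2)

def hsAux : List (Bool × Bool × ℕ) → ℕ → List ℕ
  | [], _ => []
  | v :: rest, c => if v.2.1 then hsAux rest (c + 1) else c :: hsAux rest c

/-- The sequence `h₁, …, h_m`: for each vertex with no right child (in symmetric
order, excluding the last vertex in symmetric order), the number of vertices
preceding it in symmetric order that have a right child. -/
def BinTree.hList (B : BinTree) : List ℕ := (hsAux B.inorder 0).dropLast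

/-- Leaves of the completion `γ(B)` in symmetric order, each recorded as `true`
if it is a left child of its parent and `false` if it is a right child; the
boolean argument records whether the current subtree sits as a left child. -/
def BinTree.gammaLeavesAux : BinTree → Bool → List Bool
  | .nil, isLeft => [isLeft]
  | .node l r, _ => BinTree.gammaLeavesAux l true ++ BinTree.gammaLeavesAux r false

/-- The word of the leaves of the complete binary tree `γ(B)` in symmetric order
(a = `true` for a left child, b = `false` for a right child). -/
def BinTree.leafWord : BinTree → List Bool
  | .nil => []
  | .node l r => BinTree.gammaLeavesAux l true ++ BinTree.gammaLeavesAux r false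

/-- The ballot number `(i / (i + 2e)) * binomial(i + 2e, e)`, defined by recursion. -/
def ballot : ℕ → ℕ → ℕ
  | 0, _ => 1
  | _ + 1, 0 => 0
  | e + 1, i + 1 => ballot (e + 1) i + ballot e (i + 2)
termination_by e i => (e, i)

theorem ballot_mul (e i : ℕ) :
    (ballot e i : ℚ) * (i + 2 * e) = i * ((i + 2 * e).choose e : ℕ) := by
  induction e generalizing i with
  | zero => simp [ballot]
  | succ e ihe =>
    induction i with
    | zero => simp [ballot]
    | succ i ihi =>
      have h2 := ihe (i + 2)
      have hN : i + 2 + 2 * e = i + 2 * (e + 1) := by ring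
      rw [hN] at h2
      have hN' : i + 1 + 2 * (e + 1) = i + 2 * (e + 1) + 1 := by ring
      rw [hN', Nat.choose_succ_succ]
      have hc := Nat.choose_succ_right_eq (i + 2 * (e + 1)) e
      have hs : i + 2 * (e + 1) - e = i + e + 2 := by omega
      rw [hs] at hc
      have hc' : ((i + 2 * (e + 1)).choose (e + 1) : ℚ) * (e + 1) =
          ((i + 2 * (e + 1)).choose e : ℚ) * (i + e + 2) := by exact_mod_cast hc
      have hpos : (i : ℚ) + 2 * (e + 1) ≠ 0 := by positivity
      rw [ballot]
      push_cast at ihi h2 ⊢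
      apply mul_right_cancel₀ hpos
      linear_combination (i + 1 + 2 * (e + 1) : ℚ) * (ihi + h2) - 2 * hc'

/-- Combinatorial data of a Catalan tableau: `d i` is the number of columns missing from row `i`
and `c j` is the row of the unique 1 in column `j`. -/
@[ext]
structure TableauCode where
  k : ℕ
  m : ℕ
  d : ℕ → ℕ
  c : ℕ → ℕ

namespace TableauCode

/-- The codes of Catalan tableaux of index `n + 1`. -/
structure Valid (x : TableauCode) (n : ℕ) : Prop where
  k_pos : 0 < x.k
  index : x.k + x.m = n + 1
  d_zero : x.d 0 = 0
  d_le : ∀ i < x.k, x.d i ≤ x.m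
  d_mono : ∀ i i', i ≤ i' → i' < x.k → x.d i ≤ x.d i'
  d_outside : ∀ i, x.k ≤ i → x.d i = 0
  c_outside : ∀ j, x.m ≤ j → x.c j = 0
  c_lt : ∀ j < x.m, x.c j < x.k
  d_c_le : ∀ j < x.m, x.d (x.c j) ≤ j
  c_le : ∀ j j', j < j' → j' < x.m → x.d (x.c j') ≤ j → x.c j' ≤ x.c j

/-- Row `i` is unrestricted. -/
def Free (x : TableauCode) (i : ℕ) : Prop :=
  i < x.k ∧ ∀ j < x.m, x.d i ≤ j → i ≤ x.c j

open Classical in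
/-- Number of unrestricted rows below row `i`. -/
noncomputable def rank (x : TableauCode) (i : ℕ) : ℕ := Nat.count x.Free i

/-- Number of unrestricted rows. -/
noncomputable def freeRows (x : TableauCode) : ℕ := x.rank x.k

/-- Number of ones in the first row. -/
def ones (x : TableauCode) : ℕ := Nat.count (fun j => x.c j = 0) x.m

/-- Add an empty row on top. -/
def addRow (x : TableauCode) : TableauCode :=
  ⟨x.k + 1, x.m, Function.update x.d x.k x.m, x.c⟩

/-- Add a full column on the right with its 1 in row `i`. -/
def addCol (x : TableauCode) (i : ℕ) : TableauCode :=
  ⟨x.k, x.m + 1, x.d, Function.update x.c x.m i⟩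

variable {x y : TableauCode} {n i : ℕ}

theorem rank_succ_of_free (h : x.Free i) : x.rank (i + 1) = x.rank i + 1 := by
  simp [rank, Nat.count_succ, h]

theorem rank_succ_of_not_free (h : ¬ x.Free i) : x.rank (i + 1) = x.rank i := by
  simp [rank, Nat.count_succ, h]

theorem rank_congr (k : ℕ) (h : ∀ i < k, (x.Free i ↔ y.Free i)) : x.rank k = y.rank k := by
  induction k with
  | zero => simp [rank]
  | succ k ih =>
    have hk := ih fun i hi => h i (by omega)
    by_cases hx : x.Free k
    · rw [rank_succ_of_free hx, rank_succ_of_free ((h k (by omega)).1 hx), hk]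
    · rw [rank_succ_of_not_free hx,
        rank_succ_of_not_free (fun hy => hx ((h k (by omega)).2 hy)), hk]

theorem rank_injective {i i' : ℕ} (hi : x.Free i) (hi' : x.Free i') (h : x.rank i = x.rank i') :
    i = i' := by
  classical
  exact Nat.count_injective hi hi' h

theorem exists_free_rank_eq {v : ℕ} (h : v < x.freeRows) : ∃ i, x.Free i ∧ x.rank i = v := by
  suffices H : ∀ k, v < x.rank k → ∃ i, x.Free i ∧ x.rank i = v from H _ h
  intro k
  induction k with
  | zero => simp [rank]
  | succ k ih =>
    intro hv
    by_cases hk : x.Free k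
    · rw [rank_succ_of_free hk] at hv
      rcases Nat.lt_succ_iff_lt_or_eq.1 hv with hv | hv
      · exact ih hv
      · exact ⟨k, hk, hv.symm⟩
    · rw [rank_succ_of_not_free hk] at hv
      exact ih hv

theorem rank_mono {i i' : ℕ} (h : i ≤ i') : x.rank i ≤ x.rank i' := by
  classical
  exact Nat.count_monotone _ h

theorem Free.rank_lt (h : x.Free i) : x.rank i < x.freeRows := by
  have := rank_mono (x := x) (Nat.succ_le_of_lt h.1)
  rw [Nat.succ_eq_add_one, rank_succ_of_free h] at this
  exact this

theorem Valid.free_zero (hx : x.Valid n) : x.Free 0 :=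
  ⟨hx.k_pos, fun _ _ _ => Nat.zero_le _⟩

theorem Valid.freeRows_pos (hx : x.Valid n) : 0 < x.freeRows :=
  (Nat.zero_le _).trans_lt hx.free_zero.rank_lt

theorem Valid.rank_eq_zero_iff (hx : x.Valid n) (hi : x.Free i) : x.rank i = 0 ↔ i = 0 := by
  constructor
  · intro h
    exact rank_injective hi hx.free_zero (by simpa [rank] using h)
  · rintro rfl
    simp [rank]

theorem Valid.freeRows_add_ones_le (hx : x.Valid n) : x.freeRows + x.ones ≤ n + 1 := by
  classical
  rw [← hx.index]
  exact add_le_add (Nat.count_le _) (Nat.count_le _)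

theorem Valid.addRow (hx : x.Valid n) : x.addRow.Valid (n + 1) := by
  obtain ⟨h1, h2, h3, h4, h5, h6, h7, h8, h9, h10⟩ := hx
  refine ⟨?_, ?_, ?_, ?_, ?_, ?_, h7, ?_, ?_, ?_⟩ <;>
    simp only [TableauCode.addRow, Function.update_apply] <;> grind

theorem Valid.addCol (hx : x.Valid n) (hi : x.Free i) : (x.addCol i).Valid (n + 1) := by
  obtain ⟨h1, h2, h3, h4, h5, h6, h7, h8, h9, h10⟩ := hx
  obtain ⟨hik, hic⟩ := hi
  refine ⟨h1, ?_, h3, ?_, h5, h6, ?_, ?_, ?_, ?_⟩ <;>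
    simp only [TableauCode.addCol, Function.update_apply] <;> grind

theorem freeRows_addRow : x.addRow.freeRows = x.freeRows + 1 := by
  have hk : x.addRow.Free x.k := by
    refine ⟨by simp [TableauCode.addRow], fun j hj h => ?_⟩
    simp [TableauCode.addRow] at h hj
    omega
  change x.addRow.rank (x.k + 1) = _
  rw [rank_succ_of_free hk]
  congr 1
  refine rank_congr _ fun i hi => ?_
  simp [Free, TableauCode.addRow, hi, hi.ne, hi.trans (Nat.lt_succ_self _)]

theorem ones_addRow : x.addRow.ones = x.ones := rfl

theorem Valid.freeRows_addCol (hx : x.Valid n) (hi : x.Free i) :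
    (x.addCol i).freeRows = x.rank i + 1 := by
  have key : ∀ i', (x.addCol i).Free i' ↔ x.Free i' ∧ i' ≤ i := by
    intro i'
    have := hx.d_le i'
    simp only [Free, TableauCode.addCol, Function.update_apply]
    grind
  have h1 : (x.addCol i).rank (i + 1) = x.rank (i + 1) :=
    rank_congr _ fun i' h => by rw [key]; exact and_iff_left (by omega)
  have h2 : ∀ t, (x.addCol i).rank (i + 1 + t) = (x.addCol i).rank (i + 1) := by
    intro t
    induction t with
    | zero => rfl
    | succ t ih =>
      rw [← ih, ← add_assoc, rank_succ_of_not_free]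
      rw [key]
      omega
  have h3 := h2 (x.k - (i + 1))
  rw [Nat.add_sub_cancel' (Nat.succ_le_of_lt hi.1)] at h3
  rw [← rank_succ_of_free hi, ← h1, ← h3]
  rfl

theorem ones_addCol : (x.addCol i).ones = x.ones + if i = 0 then 1 else 0 := by
  have h : ∀ t ≤ x.m, Nat.count (fun j => Function.update x.c x.m i j = 0) t =
      Nat.count (fun j => x.c j = 0) t := by
    intro t ht
    induction t with
    | zero => simp
    | succ t ih =>
      have : t ≠ x.m := by omega
      simp [Nat.count_succ, ih (by omega), this]
  change Nat.count (fun j => Function.update x.c x.m i j = 0) (x.m + 1) = _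
  rw [Nat.count_succ, h _ le_rfl, Function.update_self]
  rfl

theorem Valid.eq_addRow_or_eq_addCol (hy : y.Valid (n + 1)) :
    (∃ x : TableauCode, x.Valid n ∧ y = x.addRow) ∨
      ∃ x : TableauCode, x.Valid n ∧ ∃ i, x.Free i ∧ y = x.addCol i := by
  obtain ⟨k, m, d, c⟩ := y
  obtain ⟨h1, h2, h3, h4, h5, h6, h7, h8, h9, h10⟩ := hy
  simp only at *
  obtain ⟨k, rfl⟩ : ∃ k', k = k' + 1 := ⟨k - 1, by omega⟩
  by_cases hd : d k = m ∧ 0 < k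
  · left
    refine ⟨⟨k, m, Function.update d k 0, c⟩, ?_, ?_⟩
    · have hc : ∀ j < m, c j < k := by
        intro j hj
        have := h8 j hj
        have := h9 j hj
        grind
      constructor <;> simp only [Function.update_apply] <;> grind
    · simp [TableauCode.addRow, hd.1]
  · right
    have hdk : d k < m := by
      have := h4 k (by omega)
      rcases Nat.eq_zero_or_pos k with rfl | hk <;> omega
    obtain ⟨m, rfl⟩ : ∃ m', m = m' + 1 := ⟨m - 1, by omega⟩
    have hd' : ∀ i < k + 1, d i ≤ m := fun i hi => by
      have := h5 i k (by omega) (by omega)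
      omega
    refine ⟨⟨k + 1, m, d, Function.update c m 0⟩, ?_, c m, ⟨?_, ?_⟩, ?_⟩
    · constructor <;> simp only [Function.update_apply] <;> grind
    · exact h8 m (by omega)
    · simp only [Function.update_apply]
      grind
    · simp [TableauCode.addCol]

theorem Valid.addRow_injective (hx : x.Valid n) (hy : y.Valid n) (h : x.addRow = y.addRow) :
    x = y := by
  have hxo := hx.d_outside
  have hyo := hy.d_outside
  simp only [TableauCode.addRow, TableauCode.mk.injEq, Nat.add_right_cancel_iff] at h
  obtain ⟨hk, hm, hd, hc⟩ := h
  refine TableauCode.ext hk hm (funext fun i => ?_) hc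
  have := congrFun hd i
  simp only [Function.update_apply] at this
  grind

theorem Valid.addCol_injective {i' : ℕ} (hx : x.Valid n) (hy : y.Valid n)
    (h : x.addCol i = y.addCol i') : x = y := by
  have hxo := hx.c_outside
  have hyo := hy.c_outside
  simp only [TableauCode.addCol, TableauCode.mk.injEq, Nat.add_right_cancel_iff] at h
  obtain ⟨hk, hm, hd, hc⟩ := h
  refine TableauCode.ext hk hm hd (funext fun j => ?_)
  have := congrFun hc j
  simp only [Function.update_apply] at this
  grind

theorem Valid.addRow_ne_addCol (hy : y.Valid n) : x.addRow ≠ y.addCol i := by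
  intro h
  simp only [TableauCode.addRow, TableauCode.addCol, TableauCode.mk.injEq] at h
  obtain ⟨hk, hm, hd, -⟩ := h
  have := hy.d_le x.k (by omega)
  rw [← hd] at this
  simp at this
  omega

open Classical in
/-- The unique tableau with `v + 1` unrestricted rows obtained from `x` by adding a row or
column. -/
noncomputable def grow (v : ℕ) (x : TableauCode) : TableauCode :=
  if h : v < x.freeRows then x.addCol (exists_free_rank_eq h).choose else x.addRow

/-- Codes with `v + 1` unrestricted rows and `a` ones in the first row. -/
def withStats (n v a : ℕ) : Set TableauCode :=
  {x | x.Valid n ∧ x.freeRows = v + 1 ∧ x.ones = a}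

/-- Codes with at least `v` unrestricted rows and `a` ones in the first row. -/
def withStatsGE (n v a : ℕ) : Set TableauCode :=
  {x | x.Valid n ∧ v ≤ x.freeRows ∧ x.ones = a}

theorem grow_injOn (n v a : ℕ) : Set.InjOn (grow v) (withStatsGE n v a) := by
  rintro x ⟨hx, -, -⟩ y ⟨hy, -, -⟩ h
  unfold grow at h
  split_ifs at h with h1 h2 h2
  · exact hx.addCol_injective hy h
  · exact absurd h.symm hx.addRow_ne_addCol
  · exact absurd h hy.addRow_ne_addCol
  · exact hx.addRow_injective hy h

theorem image_grow (n v a : ℕ) : grow v '' withStatsGE n v a =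
    withStats (n + 1) v (a + if v = 0 then 1 else 0) := by
  ext y
  constructor
  · rintro ⟨x, ⟨hx, hv, rfl⟩, rfl⟩
    by_cases h : v < x.freeRows
    · rw [grow, dif_pos h]
      obtain ⟨hf, hr⟩ := (exists_free_rank_eq h).choose_spec
      refine ⟨hx.addCol hf, ?_, ?_⟩
      · rw [hx.freeRows_addCol hf, hr]
      · rw [ones_addCol]
        simp only [← hx.rank_eq_zero_iff hf, hr]
    · rw [grow, dif_neg h]
      have := hx.freeRows_pos
      refine ⟨hx.addRow, ?_, ?_⟩
      · rw [freeRows_addRow]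
        omega
      · rw [ones_addRow, if_neg (by omega), add_zero]
  · rintro ⟨hy, hr, ho⟩
    rcases hy.eq_addRow_or_eq_addCol with ⟨x, hx, rfl⟩ | ⟨x, hx, i, hi, rfl⟩
    · rw [freeRows_addRow, Nat.add_right_cancel_iff] at hr
      have := hx.freeRows_pos
      rw [ones_addRow, if_neg (by omega), add_zero] at ho
      exact ⟨x, ⟨hx, hr.ge, ho⟩, dif_neg (by omega)⟩
    · rw [hx.freeRows_addCol hi, Nat.add_right_cancel_iff] at hr
      have hlt : v < x.freeRows := hr ▸ hi.rank_lt
      have hz := hx.rank_eq_zero_iff hi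
      rw [hr] at hz
      simp only [ones_addCol, hz, Nat.add_right_cancel_iff] at ho
      refine ⟨x, ⟨hx, hlt.le, ho⟩, ?_⟩
      rw [grow, dif_pos hlt]
      obtain ⟨hf, hr'⟩ := (exists_free_rank_eq hlt).choose_spec
      rw [rank_injective hf hi (hr'.trans hr.symm)]

theorem encard_withStats_succ (n v a : ℕ) :
    (withStats (n + 1) v (a + if v = 0 then 1 else 0)).encard = (withStatsGE n v a).encard := by
  rw [← image_grow, (grow_injOn n v a).encard_image]

theorem withStatsGE_zero (n a : ℕ) : withStatsGE n 0 a = withStatsGE n 1 a := by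
  ext x
  constructor
  · rintro ⟨hx, -, ho⟩
    exact ⟨hx, hx.freeRows_pos, ho⟩
  · rintro ⟨hx, -, ho⟩
    exact ⟨hx, Nat.zero_le _, ho⟩

theorem withStatsGE_eq_empty {n v a : ℕ} (h : n + 1 < v + a) : withStatsGE n v a = ∅ := by
  refine Set.eq_empty_of_forall_notMem ?_
  rintro x ⟨hx, hv, rfl⟩
  have := hx.freeRows_add_ones_le
  omega

theorem encard_withStatsGE_succ (n v a : ℕ) : (withStatsGE n (v + 1) a).encard =
    (withStats n v a).encard + (withStatsGE n (v + 2) a).encard := by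
  rw [← Set.encard_union_eq]
  · congr 1
    ext x
    simp only [withStats, withStatsGE, Set.mem_union, Set.mem_ofPred_eq]
    grind
  · rw [Set.disjoint_left]
    rintro x ⟨-, h, -⟩ ⟨-, h', -⟩
    omega

theorem withStats_zero : withStats 0 0 0 = {⟨1, 0, 0, 0⟩} := by
  ext x
  constructor
  · rintro ⟨hx, -, -⟩
    have h1 := hx.k_pos
    have h2 := hx.index
    refine TableauCode.ext (by simp; omega) (by simp; omega) (funext fun i => ?_)
      (funext fun j => hx.c_outside j (by omega))
    rcases Nat.eq_zero_or_pos i with rfl | hi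
    · exact hx.d_zero
    · exact hx.d_outside i (by omega)
  · rintro rfl
    refine ⟨?_, ?_, ?_⟩
    · constructor <;> simp
    · have : Free ⟨1, 0, 0, 0⟩ 0 := ⟨by simp, by simp⟩
      change rank _ (0 + 1) = _
      rw [rank_succ_of_free this]
      simp [rank]
    · simp [ones]

theorem encard_withStats (n v a e : ℕ) (h : v + a + e = n) :
    (withStats n v a).encard = ballot e (v + a) := by
  induction n generalizing v a e with
  | zero =>
    obtain ⟨rfl, rfl, rfl⟩ : v = 0 ∧ a = 0 ∧ e = 0 := by omega
    simp [withStats_zero, ballot]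
  | succ n ih =>
    have key : ∀ e v a, v + a + e = n →
        (withStatsGE n (v + 1) a).encard = ballot e (v + a + 1) := by
      intro e
      induction e with
      | zero =>
        intro v a h
        rw [encard_withStatsGE_succ, withStatsGE_eq_empty (by omega), ih v a 0 h]
        simp [ballot]
      | succ e ihe =>
        intro v a h
        rw [encard_withStatsGE_succ, ih v a _ h, ihe (v + 1) a (by omega), ballot,
          show v + 1 + a + 1 = v + a + 2 by ring]
        push_cast
        rfl
    rcases v with _ | v
    · rcases a with _ | a
      · obtain rfl : e = n + 1 := by omega
        have : withStats (n + 1) 0 0 = ∅ := by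
          refine Set.eq_empty_of_forall_notMem fun x hx => ?_
          rcases hx.1.eq_addRow_or_eq_addCol with ⟨y, hy, rfl⟩ | ⟨y, hy, i, hi, rfl⟩
          · have h1 := hx.2.1
            have := hy.freeRows_pos
            rw [freeRows_addRow] at h1
            omega
          · have h1 := hx.2.1
            have h2 := hx.2.2
            rw [hy.freeRows_addCol hi, Nat.add_right_cancel_iff, hy.rank_eq_zero_iff hi] at h1
            simp [ones_addCol, h1] at h2
        simp [this, ballot]
      · have := encard_withStats_succ n 0 a
        rw [withStatsGE_zero, key e 0 a (by omega)] at this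
        simpa using this
    · have := encard_withStats_succ n (v + 1) a
      rw [key e v a (by omega)] at this
      simpa [add_right_comm] using this

end TableauCode

namespace CatalanTableau

variable {n : ℕ}

/-- The row of the unique 1 in column `j`. -/
noncomputable def oneRow (T : CatalanTableau n) (j : Fin T.m) : Fin T.k := (T.col_one j).choose

theorem f_eq_true_iff (T : CatalanTableau n) (i : Fin T.k) (j : Fin T.m) :
    T.f i j = true ↔ T.oneRow j = i :=
  ⟨fun h => ((T.col_one j).choose_spec.2 i h).symm, fun h => h ▸ (T.col_one j).choose_spec.1⟩

/-- The code of a Catalan tableau. -/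
noncomputable def code (T : CatalanTableau n) : TableauCode where
  k := T.k
  m := T.m
  d i := if h : i < T.k then T.m - T.lam ⟨i, h⟩ else 0
  c j := if h : j < T.m then T.oneRow ⟨j, h⟩ else 0

theorem code_d (T : CatalanTableau n) (i : Fin T.k) : T.code.d i = T.m - T.lam i := by
  simp [code]

theorem code_c (T : CatalanTableau n) (j : Fin T.m) : T.code.c j = T.oneRow j := by
  simp [code]

theorem code_valid (T : CatalanTableau (n + 1)) : T.code.Valid n where
  k_pos := T.hk
  index := T.hkm
  d_zero := by
    have := T.code_d ⟨0, T.hk⟩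
    rwa [T.lam_first, Nat.sub_self] at this
  d_le i hi := (T.code_d ⟨i, hi⟩).trans_le (Nat.sub_le _ _)
  d_mono i i' h hi' := by
    have h1 := T.code_d ⟨i, h.trans_lt hi'⟩
    have h2 := T.code_d ⟨i', hi'⟩
    have := T.lam_anti ⟨i, h.trans_lt hi'⟩ ⟨i', hi'⟩ h
    simp only at h1 h2
    omega
  d_outside i hi := dif_neg (Nat.not_lt.2 hi)
  c_outside j hj := dif_neg (Nat.not_lt.2 hj)
  c_lt j hj := (T.code_c ⟨j, hj⟩).trans_lt (T.oneRow ⟨j, hj⟩).2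
  d_c_le j hj := by
    rw [T.code_c ⟨j, hj⟩, T.code_d]
    by_contra! h
    have h1 := T.f_outside _ ⟨j, hj⟩ h
    rw [(T.f_eq_true_iff _ _).2 rfl] at h1
    exact Bool.noConfusion h1
  c_le j j' hjj hj' hd := by
    have hj : j < T.m := hjj.trans hj'
    rw [T.code_c ⟨j', hj'⟩, T.code_d] at hd
    rw [T.code_c ⟨j', hj'⟩, T.code_c ⟨j, hj⟩]
    by_contra! hlt
    have hlt' : T.oneRow ⟨j, hj⟩ < T.oneRow ⟨j', hj'⟩ := hlt
    refine T.no_bad (T.oneRow ⟨j', hj'⟩) ⟨j, hj⟩ hd ?_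
      ⟨⟨_, hlt', (T.f_eq_true_iff _ _).2 rfl⟩, ⟨j', hj'⟩, hjj, (T.f_eq_true_iff _ _).2 rfl⟩
    rw [Bool.eq_false_iff, ne_eq, T.f_eq_true_iff]
    exact hlt'.ne

theorem code_injective : Function.Injective (code : CatalanTableau n → TableauCode) := by
  intro T T' h
  have hd : ∀ i (h : i < T.k) (h' : i < T'.k), T.m - T.lam ⟨i, h⟩ = T'.m - T'.lam ⟨i, h'⟩ := by
    intro i h1 h2
    rw [← code_d, ← code_d, h]
  have hc : ∀ i j (hi : i < T.k) (hi' : i < T'.k) (hj : j < T.m) (hj' : j < T'.m),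
      T.f ⟨i, hi⟩ ⟨j, hj⟩ = T'.f ⟨i, hi'⟩ ⟨j, hj'⟩ := by
    intro i j hi hi' hj hj'
    rw [Bool.eq_iff_iff, f_eq_true_iff, f_eq_true_iff, Fin.ext_iff, Fin.ext_iff, ← code_c,
      ← code_c, h]
  have hk : T.k = T'.k := congrArg TableauCode.k h
  have hm : T.m = T'.m := congrArg TableauCode.m h
  clear h
  obtain ⟨k, m, hk0, hkm, lam, lam_le, lam_first, lam_anti, f, f1, f2, f3⟩ := T
  obtain ⟨k', m', hk0', hkm', lam', lam_le', lam_first', lam_anti', f', f1', f2', f3'⟩ := T'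
  simp only at hk hm
  subst hk hm
  obtain rfl : lam = lam' := by
    funext i
    have h1 := hd i i.2 i.2
    have h2 := lam_le i
    have h3 := lam_le' i
    simp only [Fin.eta] at h1 h3
    omega
  obtain rfl : f = f' := by
    funext i j
    exact hc i j i.2 i.2 j.2 j.2
  rfl

theorem exists_code_eq {x : TableauCode} (hx : x.Valid n) :
    ∃ T : CatalanTableau (n + 1), T.code = x := by
  have hsub : ∀ i : Fin x.k, x.m - (x.m - x.d i) = x.d i := fun i =>
    Nat.sub_sub_self (hx.d_le i i.2)
  let T : CatalanTableau (n + 1) :=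
    { k := x.k
      m := x.m
      hk := hx.k_pos
      hkm := hx.index
      lam := fun i => x.m - x.d i
      lam_le := fun i => Nat.sub_le _ _
      lam_first := by simp [hx.d_zero]
      lam_anti := fun i j hij => Nat.sub_le_sub_left (hx.d_mono i j hij j.2) _
      f := fun i j => decide (x.c j = i)
      f_outside := by
        intro i j h
        rw [hsub] at h
        rw [decide_eq_false_iff_not]
        intro hc
        have := hx.d_c_le j j.2
        rw [hc] at this
        omega
      col_one := by
        intro j
        refine ⟨⟨x.c j, hx.c_lt j j.2⟩, by simp, fun i hi => ?_⟩
        exact Fin.ext (of_decide_eq_true hi).symm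
      no_bad := by
        rintro i j h - ⟨⟨i', hi', h1⟩, j', hj', h2⟩
        rw [hsub] at h
        have h1 := of_decide_eq_true h1
        have h2 := of_decide_eq_true h2
        have := hx.c_le j j' hj' j'.2 (by rwa [h2])
        rw [h1, h2] at this
        exact absurd hi' (not_lt.2 this) }
  refine ⟨T, TableauCode.ext rfl rfl (funext fun i => ?_) (funext fun j => ?_)⟩
  · by_cases hi : i < x.k
    · exact (T.code_d ⟨i, hi⟩).trans (hsub ⟨i, hi⟩)
    · rw [hx.d_outside i (not_lt.1 hi)]
      exact dif_neg hi
  · by_cases hj : j < x.m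
    · rw [T.code_c ⟨j, hj⟩]
      have : T.f (T.oneRow ⟨j, hj⟩) ⟨j, hj⟩ = true := (T.f_eq_true_iff _ _).2 rfl
      exact (of_decide_eq_true this).symm
    · rw [hx.c_outside j (not_lt.1 hj)]
      exact dif_neg hj

theorem card_subtype_fin_eq_count (k : ℕ) (p : ℕ → Prop) [DecidablePred p] :
    Nat.card {i : Fin k // p i} = Nat.count p k := by
  let := Nat.CountSet.fintype p k
  rw [Nat.count_eq_card_fintype, ← Nat.card_eq_fintype_card]
  exact Nat.card_congr
    ⟨fun i => ⟨i.1, i.1.2, i.2⟩, fun i => ⟨⟨i.1, i.2.1⟩, i.2.2⟩, fun _ => rfl, fun _ => rfl⟩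

theorem code_ones (T : CatalanTableau n) : T.code.ones = T.onesFirstRow := by
  rw [TableauCode.ones, onesFirstRow]
  change Nat.count _ T.m = _
  rw [← card_subtype_fin_eq_count]
  refine Nat.card_congr (Equiv.subtypeEquivRight fun j => ?_)
  rw [f_eq_true_iff, code_c, Fin.ext_iff]

theorem code_free_iff (T : CatalanTableau n) (i : Fin T.k) :
    T.code.Free i ↔ ∀ j : Fin T.m, ¬ T.Restricted i j := by
  have hr : ∀ j : Fin T.m, ¬ T.Restricted i j ↔ (T.code.d i ≤ j → (i : ℕ) ≤ T.code.c j) := by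
    intro j
    rw [code_d, code_c]
    simp only [Restricted, f_eq_true_iff, Bool.eq_false_iff, ne_eq, Fin.ext_iff]
    constructor
    · intro h hd
      by_contra! hlt
      exact h ⟨hd, hlt.ne, T.oneRow j, hlt, rfl⟩
    · rintro h ⟨hd, -, i', hi', h'⟩
      have h1 := h hd
      have h2 : (i' : ℕ) < i := hi'
      omega
  simp only [hr]
  exact ⟨fun h j => h.2 j j.2, fun h => ⟨i.2, fun j hj => h ⟨j, hj⟩⟩⟩

theorem code_freeRows (T : CatalanTableau n) : T.code.freeRows = T.unrestrictedRows := by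
  classical
  rw [TableauCode.freeRows, TableauCode.rank, unrestrictedRows]
  change Nat.count _ T.k = _
  rw [← card_subtype_fin_eq_count]
  exact Nat.card_congr (Equiv.subtypeEquivRight fun i => T.code_free_iff i)

theorem card_eq_ballot (n v a e : ℕ) (h : v + a + e = n) :
    Nat.card {T : CatalanTableau (n + 1) // T.onesFirstRow = a ∧ T.unrestrictedRows = v + 1} =
      ballot e (v + a) := by
  have himage : code '' {T : CatalanTableau (n + 1) |
      T.onesFirstRow = a ∧ T.unrestrictedRows = v + 1} = TableauCode.withStats n v a := by
    ext x
    constructor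
    · rintro ⟨T, ⟨h1, h2⟩, rfl⟩
      exact ⟨T.code_valid, T.code_freeRows.trans h2, T.code_ones.trans h1⟩
    · rintro ⟨hx, h1, h2⟩
      obtain ⟨T, rfl⟩ := exists_code_eq hx
      exact ⟨T, ⟨T.code_ones.symm.trans h2, T.code_freeRows.symm.trans h1⟩, rfl⟩
  have hcard := TableauCode.encard_withStats n v a e h
  rw [← himage, code_injective.encard_image] at hcard
  change Nat.card {T : CatalanTableau (n + 1) |
      T.onesFirstRow = a ∧ T.unrestrictedRows = v + 1} = _
  rw [Nat.card_coe_set_eq, Set.ncard, hcard]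
  rfl

end CatalanTableau

/-- For all integers `n ≥ 1`, `1 ≤ i ≤ n`, `0 ≤ j ≤ i`, the number
of Catalan tableaux of index `n + 1` having exactly `j` ones in the first row
and exactly `i - j + 1` unrestricted rows equals the ballot number
`(i/(2n - i))·binomial(2n - i, n)`. -/
theorem card_catalanTableau_stats_eq_ballot
    (n i j : ℕ) (hn : 1 ≤ n) (hi1 : 1 ≤ i) (hin : i ≤ n) (hj : j ≤ i) :
    (Nat.card {T : CatalanTableau (n + 1) //
        T.onesFirstRow = j ∧ T.unrestrictedRows = i - j + 1} : ℚ) =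
      (i : ℚ) / ((2 * n - i : ℕ) : ℚ) * (((2 * n - i).choose n : ℕ) : ℚ) := by
  obtain ⟨e, rfl⟩ := Nat.exists_eq_add_of_le hin
  obtain ⟨v, rfl⟩ := Nat.exists_eq_add_of_le' hj
  rw [Nat.add_sub_cancel, CatalanTableau.card_eq_ballot _ v j e rfl]
  have hs : 2 * (v + j + e) - (v + j) = v + j + 2 * e := by omega
  have hchoose : (v + j + 2 * e).choose (v + j + e) = (v + j + 2 * e).choose e :=
    Nat.choose_symm_of_eq_add (by ring)
  have hb := ballot_mul e (v + j)
  rw [hs, hchoose, div_mul_eq_mul_div, eq_div_iff (by norm_cast; omega)]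
  push_cast at hb ⊢
  exact hb
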